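/- Let X : ℕ → ℤ be a nearest-neighbor sequence (|X_{i+1} − X_i| = 1 for all i) with X₀ = 0 such that every integer is visited infinitely often (so all the stopping times τ_{k,m} are finite). Then for all k, k' ∈ ℤ and m, m' ≥ 0: max{ X_i : τ_{k,m} ∧ τ_{k',m'} ≤ i ≤ τ_{k,m} ∨ τ_{k',m'} } = min{ j ≥ k ∨ k' : 𝓔⁺_{τ_{k,m}}(j) = 𝓔⁺_{τ_{k',m'}}(j) }, and min{ X_i : τ_{k,m} ∧ τ_{k',m'} ≤ i ≤ τ_{k,m} ∨ τ_{k',m'} } = max{ j ≤ k ∧ k' : 𝓔⁻_{τ_{k,m}}(j) = 𝓔⁻_{τ_{k',m'}}(j) }. -/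

import Mathlib

noncomputable section

/-- The local time of the sequence `X` at site `k` up to time `n` (inclusively). -/
def locTime (X : ℕ → ℤ) (n : ℕ) (k : ℤ) : ℕ :=
  ((Finset.range (n + 1)).filter fun i => X i = k).card

/-- The inverse local time `τ_{k,m}`: the time of the `(m+1)`-th visit of `X` to `k`. -/
def invLocTime (X : ℕ → ℤ) (k : ℤ) (m : ℕ) : ℕ :=
  sInf {n | m < locTime X n k}

/-- The directed edge local time `𝓔⁺_n(k)`: number of crossings of `k → k+1` before time `n`. -/
def edgePlus (X : ℕ → ℤ) (n : ℕ) (k : ℤ) : ℕ :=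
  ((Finset.range n).filter fun i => X i = k ∧ X (i + 1) = k + 1).card

/-- The directed edge local time `𝓔⁻_n(k)`: number of crossings of `k → k-1` before time `n`. -/
def edgeMinus (X : ℕ → ℤ) (n : ℕ) (k : ℤ) : ℕ :=
  ((Finset.range n).filter fun i => X i = k ∧ X (i + 1) = k - 1).card

lemma locTime_strict_of_visit {X : ℕ → ℤ} {n n' : ℕ} {k : ℤ} (h : n < n') (hk : X n' = k) :
    locTime X n k < locTime X n' k := by
  refine Finset.card_lt_card (Finset.ssubset_iff_of_subset ?_ |>.mpr ⟨n', ?_, ?_⟩)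
  · exact Finset.filter_subset_filter _ (Finset.range_subset_range.mpr (by omega))
  · simp [hk]
  · simp; omega

lemma exists_lt_locTime {X : ℕ → ℤ} (hX : ∀ k : ℤ, ∀ N : ℕ, ∃ n ≥ N, X n = k) (k : ℤ) (m : ℕ) :
    ∃ n, m < locTime X n k := by
  induction m with
  | zero =>
    obtain ⟨n, hn, hk⟩ := hX k 1
    exact ⟨n, (Nat.zero_le _).trans_lt (locTime_strict_of_visit (n := 0) (by omega) hk)⟩
  | succ m ih =>
    obtain ⟨n, hn⟩ := ih
    obtain ⟨n', hn', hk⟩ := hX k (n + 1)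
    exact ⟨n', (Nat.succ_le_of_lt hn).trans_lt (locTime_strict_of_visit (by omega) hk)⟩

/-- At the time `τ_{k,m}` the sequence sits at `k`. -/
lemma apply_invLocTime {X : ℕ → ℤ} (hX : ∀ k : ℤ, ∀ N : ℕ, ∃ n ≥ N, X n = k) (k : ℤ) (m : ℕ) :
    X (invLocTime X k m) = k := by
  have hmem : m < locTime X (invLocTime X k m) k := Nat.sInf_mem (exists_lt_locTime hX k m)
  have hmin : ∀ n < invLocTime X k m, ¬ m < locTime X n k :=
    fun n hn => Nat.notMem_of_lt_sInf (s := {n | m < locTime X n k}) hn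
  generalize invLocTime X k m = t at hmem hmin
  by_contra hne
  cases t with
  | zero => simp [locTime, Finset.filter_singleton, hne] at hmem
  | succ t =>
    apply hmin t t.lt_succ_self
    rwa [locTime, Finset.range_add_one, Finset.filter_insert, if_neg hne] at hmem

lemma edgePlus_eq_iff {X : ℕ → ℤ} {a b : ℕ} (hab : a ≤ b) (j : ℤ) :
    edgePlus X a j = edgePlus X b j ↔ ∀ i, a ≤ i → i < b → ¬ (X i = j ∧ X (i + 1) = j + 1) := by
  have hsub : (Finset.range a).filter (fun i => X i = j ∧ X (i + 1) = j + 1) ⊆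
      (Finset.range b).filter fun i => X i = j ∧ X (i + 1) = j + 1 :=
    Finset.filter_subset_filter _ (Finset.range_subset_range.mpr hab)
  constructor
  · intro h i hai hib hi
    have hmem : i ∈ (Finset.range a).filter fun i => X i = j ∧ X (i + 1) = j + 1 := by
      rw [Finset.eq_of_subset_of_card_le hsub h.ge]
      simp [hib, hi]
    simp at hmem
    omega
  · intro h
    refine congrArg Finset.card (hsub.antisymm fun i hi => ?_)
    simp only [Finset.mem_filter, Finset.mem_range] at hi ⊢
    exact ⟨not_le.mp fun hai => h i hai hi.1 hi.2, hi.2⟩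

/-- A nearest-neighbor path from a site `≤ j` to a site `> j` crosses the edge `j → j + 1`. -/
lemma exists_upcrossing {X : ℕ → ℤ} (hnn : ∀ i, |X (i + 1) - X i| = 1) {a c : ℕ} {j : ℤ}
    (hac : a ≤ c) (ha : X a ≤ j) (hc : j < X c) :
    ∃ i, a ≤ i ∧ i < c ∧ X i = j ∧ X (i + 1) = j + 1 := by
  induction c, hac using Nat.le_induction with
  | base => omega
  | succ c hac ih =>
    rcases lt_or_ge j (X c) with h | h
    · obtain ⟨i, h1, h2, h3⟩ := ih h
      exact ⟨i, h1, by omega, h3⟩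
    · have := abs_le.mp (hnn c).le
      exact ⟨c, hac, by omega, by omega, by omega⟩

lemma exists_isGreatest_isLeast_of_le {X : ℕ → ℤ} (hnn : ∀ i, |X (i + 1) - X i| = 1) {a b : ℕ}
    (hab : a ≤ b) :
    ∃ M, IsGreatest {x : ℤ | ∃ i, a ≤ i ∧ i ≤ b ∧ X i = x} M ∧
      IsLeast {j : ℤ | max (X a) (X b) ≤ j ∧ edgePlus X a j = edgePlus X b j} M := by
  obtain ⟨c, hc, hmax⟩ := (Finset.Icc a b).exists_max_image X ⟨a, by simp [hab]⟩
  simp only [Finset.mem_Icc] at hc hmax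
  refine ⟨X c, ⟨⟨c, hc.1, hc.2, rfl⟩, ?_⟩, ⟨max_le (hmax a ⟨le_rfl, hab⟩) (hmax b ⟨hab, le_rfl⟩),
    (edgePlus_eq_iff hab _).mpr fun i hai hib hi => ?_⟩, ?_⟩
  · rintro _ ⟨i, hai, hib, rfl⟩
    exact hmax i ⟨hai, hib⟩
  · have := hmax (i + 1) ⟨by omega, by omega⟩
    omega
  · rintro j ⟨hj, he⟩
    by_contra! hlt
    obtain ⟨i, hai, hic, hi⟩ := exists_upcrossing hnn hc.1 ((le_max_left _ _).trans hj) hlt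
    exact (edgePlus_eq_iff hab j).mp he i hai (by omega) hi

/-- The maximum of a nearest-neighbor path between two times is the least site, above both
endpoints, at which the two upward edge local time profiles agree. -/
lemma exists_isGreatest_isLeast {X : ℕ → ℤ} (hnn : ∀ i, |X (i + 1) - X i| = 1) (a b : ℕ) :
    ∃ M, IsGreatest {x : ℤ | ∃ i, min a b ≤ i ∧ i ≤ max a b ∧ X i = x} M ∧
      IsLeast {j : ℤ | max (X a) (X b) ≤ j ∧ edgePlus X a j = edgePlus X b j} M := by
  rcases le_total a b with hab | hab
  · simpa only [min_eq_left hab, max_eq_right hab] using exists_isGreatest_isLeast_of_le hnn hab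
  · simpa only [min_eq_right hab, max_eq_left hab, max_comm (X b), eq_comm (a := edgePlus X b _)]
      using exists_isGreatest_isLeast_of_le hnn hab

lemma edgePlus_neg (X : ℕ → ℤ) (n : ℕ) (j : ℤ) : edgePlus (-X) n (-j) = edgeMinus X n j := by
  refine congrArg Finset.card (Finset.filter_congr fun i _ => ?_)
  simp only [Pi.neg_apply]
  omega

/-- The minimum of a nearest-neighbor path between two times is the greatest site, below both
endpoints, at which the two downward edge local time profiles agree. -/
lemma exists_isLeast_isGreatest {X : ℕ → ℤ} (hnn : ∀ i, |X (i + 1) - X i| = 1) (a b : ℕ) :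
    ∃ M, IsLeast {x : ℤ | ∃ i, min a b ≤ i ∧ i ≤ max a b ∧ X i = x} M ∧
      IsGreatest {j : ℤ | j ≤ min (X a) (X b) ∧ edgeMinus X a j = edgeMinus X b j} M := by
  have hneg : ∀ i, |(-X) (i + 1) - (-X) i| = 1 := fun i => by
    rw [← hnn i, ← abs_neg]
    simp only [Pi.neg_apply]
    ring_nf
  obtain ⟨M, ⟨⟨i, hi1, hi2, hi⟩, hub⟩, ⟨hM, he⟩, hlb⟩ := exists_isGreatest_isLeast hneg a b
  simp only [Pi.neg_apply] at hi hM
  refine ⟨-M, ⟨⟨i, hi1, hi2, by omega⟩, ?_⟩, ⟨by omega, ?_⟩, ?_⟩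
  · rintro _ ⟨l, hl1, hl2, rfl⟩
    exact neg_le.mp (hub ⟨l, hl1, hl2, rfl⟩)
  · rw [← edgePlus_neg, ← edgePlus_neg, neg_neg, he]
  · rintro j ⟨hj, hje⟩
    refine le_neg.mp (hlb ⟨?_, ?_⟩)
    · simp only [Pi.neg_apply]
      omega
    · rw [edgePlus_neg, edgePlus_neg, hje]

/-- The extremes of a nearest-neighbor path between the stopping times `τ_{k,m}` and
`τ_{k',m'}` coincide with the merge points of the directed edge local time profiles. -/
theorem extremes_eq_merge_points (X : ℕ → ℤ) (hnn : ∀ i, |X (i + 1) - X i| = 1)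
    (h0 : X 0 = 0) (hX : ∀ k : ℤ, ∀ N : ℕ, ∃ n ≥ N, X n = k) :
    ∀ (k k' : ℤ) (m m' : ℕ),
      (sSup {x : ℤ | ∃ i : ℕ,
          min (invLocTime X k m) (invLocTime X k' m') ≤ i ∧
            i ≤ max (invLocTime X k m) (invLocTime X k' m') ∧ X i = x} =
        sInf {j : ℤ | max k k' ≤ j ∧
          edgePlus X (invLocTime X k m) j = edgePlus X (invLocTime X k' m') j}) ∧
      (sInf {x : ℤ | ∃ i : ℕ,
          min (invLocTime X k m) (invLocTime X k' m') ≤ i ∧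
            i ≤ max (invLocTime X k m) (invLocTime X k' m') ∧ X i = x} =
        sSup {j : ℤ | j ≤ min k k' ∧
          edgeMinus X (invLocTime X k m) j = edgeMinus X (invLocTime X k' m') j}) := by
  intro k k' m m'
  obtain ⟨M, hM, hM'⟩ :=
    exists_isGreatest_isLeast hnn (invLocTime X k m) (invLocTime X k' m')
  obtain ⟨N, hN, hN'⟩ :=
    exists_isLeast_isGreatest hnn (invLocTime X k m) (invLocTime X k' m')
  rw [apply_invLocTime hX, apply_invLocTime hX] at hM' hN'
  exact ⟨hM.csSup_eq.trans hM'.csInf_eq.symm, hN.csInf_eq.trans hN'.csSup_eq.symm⟩
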